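/- Fix c ∈ ℝ and set ρ_n = 1 + c/n. Then the deterministic sums satisfy, as n → ∞: n^{-3} Σ_{t=2}^n ( Σ_{j=0}^{t-2} ρ_n^j )² → ∫_0^1 J_c(s)² ds, where J_c(s) = (e^{cs} − 1)/c for c ≠ 0 and J_0(s) = s. -/

import Mathlib

open MeasureTheory ProbabilityTheory Filter Topology Real
open scoped BigOperators NNReal

noncomputable section

/-- J_c(s) = lim_{a → c} (1 - e^{as})/(-a), i.e. (e^{cs} - 1)/c for c ≠ 0 and s for c = 0. -/
def J (c s : ℝ) : ℝ := if c = 0 then s else (Real.exp (c * s) - 1) / c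

lemma sum_Icc_two_eq_sum_range (f : ℕ → ℝ) (hf : f 0 = 0) {n : ℕ} (hn : 1 ≤ n) :
    ∑ t ∈ Finset.Icc 2 n, f (t - 1) = ∑ k ∈ Finset.range n, f k := by
  induction n, hn using Nat.le_induction with
  | base => simp [hf]
  | succ m hm ih =>
    rw [Finset.sum_Icc_succ_top (by omega), ih, Finset.sum_range_succ, Nat.add_sub_cancel]

lemma integral_J_zero_sq : ∫ s in (0 : ℝ)..1, (J 0 s) ^ 2 = 1 / 3 := by
  simp [J]
  norm_num

lemma integral_J_sq {c : ℝ} (hc : c ≠ 0) :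
    ∫ s in (0 : ℝ)..1, (J c s) ^ 2 =
      ((Real.exp c ^ 2 - 1) / (c * 2) - 2 * ((Real.exp c - 1) / c) + 1) / c ^ 2 := by
  have hderiv (s : ℝ) : HasDerivAt
      (fun s => (Real.exp (c * s) ^ 2 / (c * 2) - 2 * (Real.exp (c * s) / c) + s) / c ^ 2)
      ((J c s) ^ 2) s := by
    have hexp : HasDerivAt (fun s => Real.exp (c * s)) (Real.exp (c * s) * c) s := by
      simpa using ((hasDerivAt_id s).const_mul c).exp
    refine (((((hexp.pow 2).div_const (c * 2)).sub
      ((hexp.div_const c).const_mul 2)).add (hasDerivAt_id s)).div_const (c ^ 2)).congr_deriv ?_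
    simp only [J, if_neg hc]
    push_cast
    field_simp
    ring
  have hcont : Continuous fun s => (J c s) ^ 2 := by
    simp only [J, if_neg hc]
    fun_prop
  rw [intervalIntegral.integral_eq_sub_of_hasDerivAt (fun s _ => hderiv s)
    (hcont.intervalIntegrable 0 1)]
  simp only [mul_one, mul_zero, Real.exp_zero]
  ring

lemma sum_range_natCast_sq (n : ℕ) :
    ∑ k ∈ Finset.range n, (k : ℝ) ^ 2 = (n - 1) * n * (2 * n - 1) / 6 := by
  induction n with
  | zero => simp
  | succ n ih =>
    rw [Finset.sum_range_succ, ih]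
    push_cast
    ring

lemma sum_geom_sum_sq {r : ℝ} (h1 : r ≠ 1) (h2 : r ^ 2 ≠ 1) (n : ℕ) :
    ∑ k ∈ Finset.range n, (∑ j ∈ Finset.range k, r ^ j) ^ 2 =
      (((r ^ n) ^ 2 - 1) / (r ^ 2 - 1) - 2 * ((r ^ n - 1) / (r - 1)) + n) / (r - 1) ^ 2 := by
  have hk (k : ℕ) : (∑ j ∈ Finset.range k, r ^ j) ^ 2 =
      ((r ^ 2) ^ k - 2 * r ^ k + 1) / (r - 1) ^ 2 := by
    rw [geom_sum_eq h1, div_pow]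
    congr 1
    ring
  simp_rw [hk]
  rw [← Finset.sum_div, Finset.sum_add_distrib, Finset.sum_sub_distrib, ← Finset.mul_sum,
    geom_sum_eq h1, geom_sum_eq h2, pow_right_comm]
  simp

theorem stmt13 (c : ℝ) :
    -- n⁻³ ∑_{t=2}^n (∑_{j=0}^{t-2} ρₙʲ)² → ∫₀¹ J_c(s)² ds, where ρₙ = 1 + c/n
    Tendsto (fun n : ℕ =>
        (∑ t ∈ Finset.Icc 2 n,
            (∑ j ∈ Finset.range (t - 1), (1 + c / (n : ℝ)) ^ j) ^ 2) / (n : ℝ) ^ 3)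
      atTop (𝓝 (∫ s in (0:ℝ)..1, (J c s) ^ 2)) := by
  have hdiv (a : ℝ) : Tendsto (fun n : ℕ => a / (n : ℝ)) atTop (𝓝 0) :=
    tendsto_const_div_atTop_nhds_zero_nat a
  have hsum (n : ℕ) (hn : 1 ≤ n) := sum_Icc_two_eq_sum_range
    (fun k => (∑ j ∈ Finset.range k, (1 + c / (n : ℝ)) ^ j) ^ 2) (by simp) hn
  by_cases hc : c = 0
  · subst hc
    rw [integral_J_zero_sq]
    have hlim : Tendsto (fun n : ℕ => (1 - 1 / (n : ℝ)) * (2 - 1 / (n : ℝ)) / 6) atTop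
        (𝓝 ((1 - 0) * (2 - 0) / 6)) :=
      (((hdiv 1).const_sub 1).mul ((hdiv 1).const_sub 2)).div_const 6
    rw [show (1 : ℝ) / 3 = (1 - 0) * (2 - 0) / 6 by norm_num]
    refine hlim.congr' ?_
    filter_upwards [eventually_ge_atTop 1] with n hn
    have hn0 : (n : ℝ) ≠ 0 := by positivity
    rw [hsum n hn]
    simp only [zero_div, add_zero, one_pow, Finset.sum_const, Finset.card_range, nsmul_eq_mul,
      mul_one, sum_range_natCast_sq]
    field_simp
  · rw [integral_J_sq hc]
    have hpow : Tendsto (fun n : ℕ => (1 + c / (n : ℝ)) ^ n) atTop (𝓝 (Real.exp c)) :=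
      Real.tendsto_one_add_div_pow_exp c
    have hden : Tendsto (fun n : ℕ => 2 + c / (n : ℝ)) atTop (𝓝 2) := by
      simpa using (hdiv c).const_add 2
    have hlim := (((((hpow.pow 2).sub_const 1).div (hden.const_mul c)
      (mul_ne_zero hc two_ne_zero)).sub
        (((hpow.sub_const 1).div_const c).const_mul 2)).add_const 1).div_const (c ^ 2)
    refine hlim.congr' ?_
    filter_upwards [eventually_ge_atTop 1, hden.eventually_ne two_ne_zero] with n hn hn2
    have hn0 : (n : ℝ) ≠ 0 := by positivity
    have hcn : c / (n : ℝ) ≠ 0 := div_ne_zero hc hn0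
    have hsq : (1 + c / (n : ℝ)) ^ 2 - 1 = c / n * (2 + c / n) := by ring
    have h1 : 1 + c / (n : ℝ) ≠ 1 := by simpa using ⟨hc, by omega⟩
    have h2 : (1 + c / (n : ℝ)) ^ 2 ≠ 1 := by
      rw [← sub_ne_zero, hsq]
      exact mul_ne_zero hcn hn2
    rw [hsum n hn, sum_geom_sum_sq h1 h2, hsq, add_sub_cancel_left]
    simp only [Pi.div_apply]
    generalize (1 + c / (n : ℝ)) ^ n = p
    generalize 2 + c / (n : ℝ) = q at hn2 ⊢
    field_simp
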